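/- Let k be a field of characteristic 0, t transcendental over k, and λ a k-linear embedding of k(t) into an algebraic closure with λ(t) = α + √m, where α ∈ k and m = (at²+bt+c)/(dt²+et+f) with a,b,c,d,e,f ∈ k, a,d not both zero, ae = bd, af ≠ cd, b² ≠ 4ac, e² ≠ 4df. Then [K(λ):K] = 2 and [K(λ):λ(K)] = 2, where K = k(t) and K(λ) = k(t, √m). -/

import Mathlib

open Polynomial

set_option synthInstance.maxHeartbeats 1000000
set_option maxHeartbeats 1000000

/-- A quotient of two quadratics with proportional leading parts is not a square. -/
theorem not_isSquare_quadratic_div_quadratic {k : Type*} [Field k] [CharZero k]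
    {a b c d e f : k} (ha : a ≠ 0) (hd : d ≠ 0) (h1 : a * e = b * d) (h2 : a * f ≠ c * d) :
    ¬ IsSquare (algebraMap k[X] (RatFunc k) (C a * X ^ 2 + C b * X + C c) /
      algebraMap k[X] (RatFunc k) (C d * X ^ 2 + C e * X + C f)) := by
  rintro ⟨r, hr⟩
  set N : k[X] := C a * X ^ 2 + C b * X + C c with hN
  set D : k[X] := C d * X ^ 2 + C e * X + C f with hD
  have hD0 : algebraMap k[X] (RatFunc k) D ≠ 0 := by
    rw [Ne, FaithfulSMul.algebraMap_eq_zero_iff]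
    exact ne_zero_of_natDegree_gt (n := 1) (by rw [hD, natDegree_quadratic hd]; norm_num)
  rw [div_eq_iff hD0] at hr
  have hsq : (r * algebraMap k[X] (RatFunc k) D) ^ 2 = algebraMap k[X] (RatFunc k) (N * D) := by
    rw [map_mul, hr]; ring
  obtain ⟨P, hP⟩ := IsIntegrallyClosed.exists_algebraMap_eq_of_isIntegral_pow (R := k[X])
    (K := RatFunc k) (n := 2) two_pos (hsq ▸ isIntegral_algebraMap)
  rw [← hP, ← map_pow] at hsq
  have hPND : P ^ 2 = N * D := FaithfulSMul.algebraMap_injective k[X] (RatFunc k) hsq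
  have hdeg : P.natDegree = 2 := by
    have hND := congrArg natDegree hPND
    rw [natDegree_pow, natDegree_mul, natDegree_quadratic ha, natDegree_quadratic hd] at hND
    · lia
    · exact ne_zero_of_natDegree_gt (n := 1) (by rw [hN, natDegree_quadratic ha]; norm_num)
    · exact ne_zero_of_natDegree_gt (n := 1) (by rw [hD, natDegree_quadratic hd]; norm_num)
  have hform : P = C (P.coeff 2) * X ^ 2 + C (P.coeff 1) * X + C (P.coeff 0) :=
    eq_quadratic_of_degree_le_two (natDegree_le_iff_degree_le.mp hdeg.le)
  generalize P.coeff 2 = p, P.coeff 1 = q, P.coeff 0 = u at hform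
  have hexp : C (p ^ 2 - a * d) * X ^ 4 + C (2 * p * q - (a * e + b * d)) * X ^ 3 +
      C (2 * p * u + q ^ 2 - (a * f + b * e + c * d)) * X ^ 2 +
      C (2 * q * u - (b * f + c * e)) * X + C (u ^ 2 - c * f) = 0 := by
    rw [hform, hN, hD, ← sub_eq_zero] at hPND
    rw [← hPND]
    simp only [map_sub, map_add, map_mul, map_pow, map_ofNat]
    ring
  have e4 : p ^ 2 - a * d = 0 := by
    simpa [coeff_X, coeff_C, coeff_X_pow, -map_sub, -map_mul, -map_add] using
      congrArg (coeff · 4) hexp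
  have e3 : 2 * p * q - (a * e + b * d) = 0 := by
    simpa [coeff_X, coeff_C, coeff_X_pow, -map_sub, -map_mul, -map_add] using
      congrArg (coeff · 3) hexp
  have e2 : 2 * p * u + q ^ 2 - (a * f + b * e + c * d) = 0 := by
    simpa [coeff_X, coeff_C, coeff_X_pow, -map_sub, -map_mul, -map_add] using
      congrArg (coeff · 2) hexp
  have e0 : u ^ 2 - c * f = 0 := by
    simpa [coeff_X, coeff_C, coeff_X_pow, -map_sub, -map_mul, -map_add] using
      congrArg (coeff · 0) hexp
  have hpq : p * q = a * e := by
    refine mul_left_cancel₀ (two_ne_zero (α := k)) ?_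
    linear_combination e3 - h1
  have hq : q ^ 2 = b * e := by
    refine mul_left_cancel₀ (mul_ne_zero ha hd) ?_
    linear_combination (p * q + a * e) * hpq - q ^ 2 * e4 + a * e * h1
  have hpu : 2 * p * u = a * f + c * d := by linear_combination e2 - hq
  refine h2 (sub_eq_zero.mp (pow_eq_zero_iff two_ne_zero |>.mp ?_))
  linear_combination -(2 * p * u + a * f + c * d) * hpu + 4 * u ^ 2 * e4 + 4 * a * d * e0

open IntermediateField in
/-- An extension generated by a square root of a nonsquare has degree two. -/
theorem finrank_adjoin_sqrt {F L : Type*} [Field F] [Field L] [Algebra F L] {m : F}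
    (hm : ¬ IsSquare m) {y : L} (hy : y ^ 2 = algebraMap F L m) :
    Module.finrank F F⟮y⟯ = 2 := by
  have hirr : Irreducible (X ^ 2 - C m) :=
    X_pow_sub_C_irreducible_of_prime Nat.prime_two fun z hz => hm ⟨z, by rw [← hz, sq]⟩
  have hmin : X ^ 2 - C m = minpoly F y :=
    minpoly.eq_of_irreducible_of_monic hirr (by simp [hy]) (monic_X_pow_sub_C m two_ne_zero)
  have hint : IsIntegral F y :=
    ⟨X ^ 2 - C m, monic_X_pow_sub_C m two_ne_zero, by simp [hy]⟩
  rw [IntermediateField.adjoin.finrank hint, ← hmin, natDegree_X_pow_sub_C]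

/-- A subfield containing the constants and the image of `X` contains the image of `RatFunc k`. -/
theorem RatFunc.algHom_mem_subfield {k Ω : Type*} [Field k] [Field Ω] [Algebra k Ω]
    (g : RatFunc k →ₐ[k] Ω) (S : Subfield Ω) (hk : ∀ x, algebraMap k Ω x ∈ S)
    (hX : g RatFunc.X ∈ S) (x : RatFunc k) : g x ∈ S := by
  have hpoly (p : k[X]) : g (algebraMap k[X] (RatFunc k) p) ∈ S := by
    induction p using Polynomial.induction_on' with
    | add p q hp hq => simpa using add_mem hp hq
    | monomial n r =>
      rw [← C_mul_X_pow_eq_monomial, map_mul, map_mul, map_pow, map_pow, RatFunc.algebraMap_X,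
        RatFunc.algebraMap_C, ← RatFunc.algebraMap_eq_C, g.commutes]
      exact mul_mem (hk r) (pow_mem hX n)
  rw [← RatFunc.num_div_denom x, map_div₀]
  exact div_mem (hpoly _) (hpoly _)

/-- Let `k` be a field of characteristic `0`, `t` transcendental over `k`
(so `K = k(t) = RatFunc k`), and `λ` a `k`-linear embedding of `k(t)` into an algebraic
closure `Ω` of `K` with `λ(t) = α + √m`, where `α ∈ k` and
`m = (a t² + b t + c)/(d t² + e t + f)` with `a,…,f ∈ k`, `a, d` not both zero,
`a e = b d`, `a f ≠ c d`, `b² ≠ 4 a c`, `e² ≠ 4 d f`.  Then `[K(λ) : K] = 2` and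
`[K(λ) : λ(K)] = 2`, where `K(λ) = k(t, √m)` is the composite of `K` and `λ(K)` inside
`Ω` (the right-hand degree is the dimension of `K(λ)` for the `K`-structure induced by
`λ`, i.e. the degree of `K(λ)` over `λ(K)`). -/
theorem stmt17 (k : Type*) [Field k] [CharZero k]
    (Ω : Type*) [Field Ω] [Algebra (RatFunc k) Ω] [Algebra k Ω]
    [IsScalarTower k (RatFunc k) Ω] [IsAlgClosure (RatFunc k) Ω]
    (α a b c d e f : k)
    (had : ¬(a = 0 ∧ d = 0)) (h1 : a * e = b * d) (h2 : a * f ≠ c * d)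
    (h3 : b ^ 2 ≠ 4 * a * c) (h4 : e ^ 2 ≠ 4 * d * f)
    (m : RatFunc k)
    (hm : m = algebraMap (Polynomial k) (RatFunc k) (C a * X ^ 2 + C b * X + C c) /
      algebraMap (Polynomial k) (RatFunc k) (C d * X ^ 2 + C e * X + C f))
    (s : Ω) (hs : s ^ 2 = algebraMap (RatFunc k) Ω m)
    (lam : RatFunc k →ₐ[k] Ω)
    (hlamt : lam RatFunc.X = algebraMap k Ω α + s) :
    Module.finrank (RatFunc k)
      ↥(IntermediateField.adjoin (RatFunc k) (Set.range lam)) = 2 ∧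
    @Module.finrank (RatFunc k)
      ↥(IntermediateField.adjoin (RatFunc k) (Set.range lam)) _ _
      (Module.compHom _ ((lam : RatFunc k →+* Ω).codRestrict
        (IntermediateField.adjoin (RatFunc k) (Set.range lam))
        (fun x => IntermediateField.subset_adjoin (RatFunc k) (Set.range lam) ⟨x, rfl⟩))) =
      2 := by
  have hd : d ≠ 0 := by
    rintro rfl
    have ha : a ≠ 0 := fun h => had ⟨h, rfl⟩
    have he : e = 0 := by simpa [ha] using h1
    simp [he] at h4
  have ha : a ≠ 0 := by
    rintro rfl
    have hb : b = 0 := by simpa [hd] using h1.symm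
    simp [hb] at h3
  have hmsq : ¬ IsSquare m := hm ▸ not_isSquare_quadratic_div_quadratic ha hd h1 h2
  have hcompat (x : k) : algebraMap (RatFunc k) Ω (algebraMap k (RatFunc k) x) =
      algebraMap k Ω x := (IsScalarTower.algebraMap_apply k (RatFunc k) Ω x).symm
  set E := IntermediateField.adjoin (RatFunc k) (Set.range lam) with hE
  have hlamE (x : RatFunc k) : lam x ∈ E :=
    IntermediateField.subset_adjoin (RatFunc k) (Set.range lam) ⟨x, rfl⟩
  constructor
  · have hEs : E = IntermediateField.adjoin (RatFunc k) {s} := by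
      apply le_antisymm
      · rw [hE, IntermediateField.adjoin_le_iff]
        rintro _ ⟨x, rfl⟩
        have hk (z : k) : algebraMap k Ω z ∈ IntermediateField.adjoin (RatFunc k) {s} :=
          hcompat z ▸ IntermediateField.algebraMap_mem _ _
        refine RatFunc.algHom_mem_subfield lam
          (IntermediateField.adjoin (RatFunc k) {s}).toSubfield hk ?_ x
        rw [hlamt]
        exact add_mem (hk α) (IntermediateField.mem_adjoin_simple_self _ s)
      · rw [IntermediateField.adjoin_simple_le_iff]
        have hs' : s = lam RatFunc.X - algebraMap k Ω α := by rw [hlamt]; ring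
        rw [hs', ← hcompat]
        exact sub_mem (hlamE _) (E.algebraMap_mem _)
    change Module.finrank (RatFunc k) E = 2
    rw [hEs]
    exact finrank_adjoin_sqrt hmsq hs
  · let algE : Algebra (RatFunc k) E := ((lam : RatFunc k →+* Ω).codRestrict E hlamE).toAlgebra
    set h := b / (2 * a) with hh
    set c' := c - a * h ^ 2 with hc'
    set f' := f - d * h ^ 2 with hf'
    have hb : b = 2 * a * h := by rw [hh]; field_simp
    have he : e = 2 * d * h := by
      refine mul_left_cancel₀ ha ?_
      linear_combination h1 + d * hb
    have hf0 : f' ≠ 0 := fun h0 => h4 (by rw [he]; linear_combination -4 * d * h0 - 4 * d * hf')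
    have hdet : a * f' ≠ c' * d := fun h0 => h2 (by linear_combination h0 - a * hf' + d * hc')
    set T : Ω := algebraMap (RatFunc k) Ω RatFunc.X with hT
    set κ := algebraMap k Ω with hκ
    have hκ0 {z : k} (hz : z ≠ 0) : κ z ≠ 0 := by simpa using hz
    have hpoly (u v w : k) : algebraMap (RatFunc k) Ω (algebraMap k[X] (RatFunc k)
        (C u * X ^ 2 + C v * X + C w)) = κ u * T ^ 2 + κ v * T + κ w := by
      simp [← RatFunc.algebraMap_eq_C, hcompat, hT]
    have hlam (u v w : k) : lam (algebraMap k[X] (RatFunc k)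
        (C u * X ^ 2 + C v * X + C w)) = κ u * (κ α + s) ^ 2 + κ v * (κ α + s) + κ w := by
      simp [← RatFunc.algebraMap_eq_C, hlamt, hκ]
    have hD0 : κ d * T ^ 2 + κ e * T + κ f ≠ 0 := by
      rw [← hpoly, Ne, FaithfulSMul.algebraMap_eq_zero_iff, FaithfulSMul.algebraMap_eq_zero_iff]
      exact ne_zero_of_natDegree_gt (n := 1) (by rw [natDegree_quadratic hd]; norm_num)
    have hrel : (T + κ h) ^ 2 * (κ d * s ^ 2 - κ a) = κ c' - κ f' * s ^ 2 := by
      rw [hm, map_div₀, hpoly, hpoly, eq_div_iff hD0, he, hb] at hs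
      simp only [hc', hf', map_sub, map_mul, map_pow, map_ofNat] at hs ⊢
      linear_combination hs
    have hden : κ d * s ^ 2 - κ a ≠ 0 := by
      intro h0
      rw [h0, mul_zero] at hrel
      refine hκ0 (sub_ne_zero.mpr hdet) ?_
      rw [map_sub, map_mul, map_mul]
      linear_combination κ d * hrel - κ f' * h0
    have hnsq := not_isSquare_quadratic_div_quadratic (a := -f') (b := 2 * α * f')
      (c := c' - f' * α ^ 2) (d := d) (e := -(2 * α * d)) (f := d * α ^ 2 - a)
      (neg_ne_zero.mpr hf0) hd (by ring) (fun h0 => hdet (by linear_combination h0))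
    have hTE : T ∈ E := E.algebraMap_mem _
    have hκE (z : k) : κ z ∈ E := hcompat z ▸ E.algebraMap_mem _
    have hy : (⟨T + κ h, add_mem hTE (hκE h)⟩ : E) ^ 2 = algebraMap (RatFunc k) E
        (algebraMap k[X] (RatFunc k)
            (C (-f') * X ^ 2 + C (2 * α * f') * X + C (c' - f' * α ^ 2)) /
          algebraMap k[X] (RatFunc k)
            (C d * X ^ 2 + C (-(2 * α * d)) * X + C (d * α ^ 2 - a))) := by
      refine Subtype.ext (Eq.trans ?_ (map_div₀ lam _ _).symm)
      change (T + κ h) ^ 2 = _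
      have hden' : κ d * (κ α + s) ^ 2 + κ (-(2 * α * d)) * (κ α + s) + κ (d * α ^ 2 - a) =
          κ d * s ^ 2 - κ a := by
        simp only [map_sub, map_mul, map_pow, map_ofNat, map_neg]
        ring
      rw [hlam, hlam, hden', eq_div_iff hden]
      simp only [map_sub, map_mul, map_pow, map_ofNat, map_neg]
      linear_combination hrel
    have hfin := finrank_adjoin_sqrt hnsq hy
    set M : IntermediateField (RatFunc k) E :=
      IntermediateField.adjoin (RatFunc k) {(⟨T + κ h, add_mem hTE (hκE h)⟩ : E)}
    let S : Subfield Ω := M.toSubfield.map E.toSubfield.subtype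
    have hSlam (x : RatFunc k) : lam x ∈ S :=
      ⟨algebraMap (RatFunc k) E x, M.algebraMap_mem x, rfl⟩
    have hSκ (z : k) : κ z ∈ S := lam.commutes z ▸ hSlam _
    have hST : T ∈ S := by
      have hTκ : T + κ h ∈ S := ⟨_, IntermediateField.mem_adjoin_simple_self _ _, rfl⟩
      simpa using sub_mem hTκ (hSκ h)
    have hES : E.toSubfield ≤ S := by
      refine IntermediateField.adjoin_le_subfield (RatFunc k) _ ?_ ?_
      · rintro _ ⟨x, rfl⟩
        exact RatFunc.algHom_mem_subfield (IsScalarTower.toAlgHom k (RatFunc k) Ω) S hSκ hST x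
      · rintro _ ⟨x, rfl⟩
        exact hSlam x
    have hMtop : M = ⊤ := by
      refine top_unique fun x _ => ?_
      obtain ⟨y, hyM, hyx⟩ := hES x.2
      exact (Subtype.ext hyx : y = x) ▸ hyM
    rw [hMtop, IntermediateField.finrank_top'] at hfin
    exact hfin
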